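/- Fix real constants a,b,c. Let T = q1³(q1/2+q2)p1²/(q1−q2) + q2³(q1+q2/2)p2²/(q2−q1), V̂ = a(4q1⁴+14q1³q2+19q1²q2²+14q1q2³+4q2⁴)/(q1²q2²(q1+q2)²) + b(q1+q2) + c(1/q1+1/q2), K̂1 = (p1−p2)/(q1−q2)³, K̂2 = q1²q2²(q1²p1−q2²p2)², Û1 = −4a(q1+q2)(q1²+q1q2+q2²)/(q1⁵q2⁵(q1−q2)⁴) − c(q1+q2)²/(q1⁴q2⁴(q1−q2)⁴), Û2 = −4aq1q2(q1−q2)²/(q1+q2) + 2b q1²q2²(q1−q2)². Then H1 = T+V̂ and H2 = (K̂1²+Û1)(K̂2+Û2)² satisfy {H1,H2} = 0 on the open set where q1,q2,q1−q2,q1+q2 are nonzero. -/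

import Mathlib

/-- Canonical Poisson bracket of two functions on phase space (q1,q2,p1,p2). -/
noncomputable def pb (f g : ℝ → ℝ → ℝ → ℝ → ℝ) (q1 q2 p1 p2 : ℝ) : ℝ :=
  (deriv (fun x => f x q2 p1 p2) q1) * (deriv (fun x => g q1 q2 x p2) p1)
  - (deriv (fun x => f q1 q2 x p2) p1) * (deriv (fun x => g x q2 p1 p2) q1)
  + (deriv (fun x => f q1 x p1 p2) q2) * (deriv (fun x => g q1 q2 p1 x) p2)
  - (deriv (fun x => f q1 q2 p1 x) p2) * (deriv (fun x => g q1 x p1 p2) q2)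

noncomputable def H1 (a b c q1 q2 p1 p2 : ℝ) : ℝ :=
  q1^3 * (q1/2 + q2) * p1^2 / (q1 - q2) + q2^3 * (q1 + q2/2) * p2^2 / (q2 - q1)
  + a * (4*q1^4 + 14*q1^3*q2 + 19*q1^2*q2^2 + 14*q1*q2^3 + 4*q2^4)
      / (q1^2 * q2^2 * (q1 + q2)^2)
  + b * (q1 + q2) + c * (1/q1 + 1/q2)

noncomputable def H2 (a b c q1 q2 p1 p2 : ℝ) : ℝ :=
  (((p1 - p2)/(q1 - q2)^3)^2
    + (-4*a*(q1 + q2)*(q1^2 + q1*q2 + q2^2)/(q1^5*q2^5*(q1 - q2)^4)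
        - c*(q1 + q2)^2/(q1^4*q2^4*(q1 - q2)^4)))
  * (q1^2*q2^2*(q1^2*p1 - q2^2*p2)^2
    + (-4*a*q1*q2*(q1 - q2)^2/(q1 + q2) + 2*b*q1^2*q2^2*(q1 - q2)^2))^2

/-- The factor of `H2` that is quadratic in `p1 - p2`. -/
noncomputable def factorA (a c q1 q2 p1 p2 : ℝ) : ℝ :=
  ((p1 - p2)/(q1 - q2)^3)^2
    + (-4*a*(q1 + q2)*(q1^2 + q1*q2 + q2^2)/(q1^5*q2^5*(q1 - q2)^4)
        - c*(q1 + q2)^2/(q1^4*q2^4*(q1 - q2)^4))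

/-- The factor of `H2` that occurs squared. -/
noncomputable def factorB (a b q1 q2 p1 p2 : ℝ) : ℝ :=
  q1^2*q2^2*(q1^2*p1 - q2^2*p2)^2
    + (-4*a*q1*q2*(q1 - q2)^2/(q1 + q2) + 2*b*q1^2*q2^2*(q1 - q2)^2)

/-- The partial derivative of `H1` in `q1`. -/
noncomputable def dqH1 (a b c q1 q2 p1 p2 : ℝ) : ℝ :=
  p1^2 * q1^2 * (3*q1^2 - 6*q2^2) / (2*(q1 - q2)^2)
    + 3*p2^2*q2^4 / (2*(q1 - q2)^2)
    + a * ((16*q1^3 + 42*q1^2*q2 + 38*q1*q2^2 + 14*q2^3) / (q1^2 * q2^2 * (q1 + q2)^2)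
      - (4*q1^4 + 14*q1^3*q2 + 19*q1^2*q2^2 + 14*q1*q2^3 + 4*q2^4) * (4*q1 + 2*q2)
        / (q1^3 * q2^2 * (q1 + q2)^3))
    + b - c/q1^2

/-- The partial derivative of `H1` in `p1`. -/
noncomputable def dpH1 (q1 q2 p1 : ℝ) : ℝ :=
  q1^3 * (q1 + 2*q2) * p1 / (q1 - q2)

/-- The partial derivative of `factorA` in `q1`. -/
noncomputable def dqFactorA (a c q1 q2 p1 p2 : ℝ) : ℝ :=
  -6*(p1 - p2)^2/(q1 - q2)^7
    - 4*a*((3*q1^2 + 4*q1*q2 + 2*q2^2)/(q1^5*q2^5*(q1 - q2)^4)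
      - (q1 + q2)*(q1^2 + q1*q2 + q2^2)*(9*q1 - 5*q2)/(q1^6*q2^5*(q1 - q2)^5))
    - c*(2*(q1 + q2)/(q1^4*q2^4*(q1 - q2)^4)
      - (q1 + q2)^2*(8*q1 - 4*q2)/(q1^5*q2^4*(q1 - q2)^5))

/-- The partial derivative of `factorB` in `q1`. -/
noncomputable def dqFactorB (a b q1 q2 p1 p2 : ℝ) : ℝ :=
  2*q1*q2^2*(q1^2*p1 - q2^2*p2)^2 + 4*q1^3*q2^2*p1*(q1^2*p1 - q2^2*p2)
    - 4*a*q2*((q1 - q2)*(3*q1 - q2)/(q1 + q2) - q1*(q1 - q2)^2/(q1 + q2)^2)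
    + 4*b*q1*q2^2*(q1 - q2)*(2*q1 - q2)

theorem H1_swap (a b c q1 q2 p1 p2 : ℝ) : H1 a b c q1 q2 p1 p2 = H1 a b c q2 q1 p2 p1 := by
  unfold H1; ring

theorem factorA_swap (a c q1 q2 p1 p2 : ℝ) :
    factorA a c q1 q2 p1 p2 = factorA a c q2 q1 p2 p1 := by
  have h : q2 - q1 = -(q1 - q2) := by ring
  unfold factorA; rw [h]; generalize q1 - q2 = d; ring

theorem factorB_swap (a b q1 q2 p1 p2 : ℝ) :
    factorB a b q1 q2 p1 p2 = factorB a b q2 q1 p2 p1 := by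
  unfold factorB; ring

section Derivatives

variable (a b c : ℝ) {q1 q2 : ℝ} (p1 p2 : ℝ)

theorem hasDerivAt_H1_q (h1 : q1 ≠ 0) (h2 : q2 ≠ 0) (h3 : q1 - q2 ≠ 0) (h4 : q1 + q2 ≠ 0) :
    HasDerivAt (fun x => H1 a b c x q2 p1 p2) (dqH1 a b c q1 q2 p1 p2) q1 := by
  have h3' : q2 - q1 ≠ 0 := by rw [← neg_sub]; exact neg_ne_zero.mpr h3
  have X := hasDerivAt_id q1
  have hT1 := ((((X.pow 3).mul ((X.div_const 2).add_const q2)).mul_const (p1^2)).div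
    (X.sub_const q2) h3)
  have hT2 := ((((X.add_const (q2/2)).const_mul (q2^3)).mul_const (p2^2)).div
    (X.const_sub q2) h3')
  have hP := (((((X.pow 4).const_mul 4).add (((X.pow 3).const_mul 14).mul_const q2)).add
    (((X.pow 2).const_mul 19).mul_const (q2^2))).add ((X.const_mul 14).mul_const (q2^3))).add_const
    (4*q2^4)
  have hQ := ((X.pow 2).mul_const (q2^2)).mul ((X.add_const q2).pow 2)
  have hV := (hP.const_mul a).div hQ (by simp [h1, h2, h4])
  have hb := (X.add_const q2).const_mul b
  have hc := (((hasDerivAt_const q1 (1 : ℝ)).div X h1).add_const (1/q2)).const_mul c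
  refine ((((hT1.add hT2).add hV).add hb).add hc).congr_deriv ?_
  have h3s : q2 - q1 = -(q1 - q2) := by ring
  simp only [dqH1, id, Pi.pow_apply, Pi.mul_apply, Pi.add_apply, h3s]
  field_simp
  ring

theorem hasDerivAt_H1_p :
    HasDerivAt (fun x => H1 a b c q1 q2 x p2) (dpH1 q1 q2 p1) p1 := by
  have X := hasDerivAt_id p1
  have h := (((((((X.pow 2).const_mul (q1^3 * (q1/2 + q2))).div_const (q1 - q2)).add_const
    (q2^3 * (q1 + q2/2) * p2^2 / (q2 - q1))).add_const
    (a * (4*q1^4 + 14*q1^3*q2 + 19*q1^2*q2^2 + 14*q1*q2^3 + 4*q2^4)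
      / (q1^2 * q2^2 * (q1 + q2)^2))).add_const (b * (q1 + q2))).add_const (c * (1/q1 + 1/q2)))
  refine h.congr_deriv ?_
  simp only [dpH1, id]
  ring

theorem hasDerivAt_factorA_q (h1 : q1 ≠ 0) (h2 : q2 ≠ 0) (h3 : q1 - q2 ≠ 0) :
    HasDerivAt (fun x => factorA a c x q2 p1 p2) (dqFactorA a c q1 q2 p1 p2) q1 := by
  have X := hasDerivAt_id q1
  have hd := X.sub_const q2
  have hK := ((hasDerivAt_const q1 (p1 - p2)).div (hd.pow 3) (pow_ne_zero 3 h3)).pow 2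
  have ha := (((X.add_const q2).const_mul (-4*a)).mul
    (((X.pow 2).add (X.mul_const q2)).add_const (q2^2))).div
    (((X.pow 5).mul_const (q2^5)).mul (hd.pow 4)) (by simp [h1, h2, h3])
  have hc := (((X.add_const q2).pow 2).const_mul c).div
    (((X.pow 4).mul_const (q2^4)).mul (hd.pow 4)) (by simp [h1, h2, h3])
  refine (hK.add (ha.sub hc)).congr_deriv ?_
  simp only [dqFactorA, id, Pi.pow_apply, Pi.mul_apply, Pi.add_apply, Pi.div_apply,
    Nat.reduceSub, pow_one, Nat.cast_ofNat]
  field_simp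
  ring

theorem hasDerivAt_factorA_p :
    HasDerivAt (fun x => factorA a c q1 q2 x p2) (2*(p1 - p2)/(q1 - q2)^6) p1 := by
  have h := ((((hasDerivAt_id p1).sub_const p2).div_const ((q1 - q2)^3)).pow 2).add_const
    (-4*a*(q1 + q2)*(q1^2 + q1*q2 + q2^2)/(q1^5*q2^5*(q1 - q2)^4)
        - c*(q1 + q2)^2/(q1^4*q2^4*(q1 - q2)^4))
  refine h.congr_deriv ?_
  simp only [id]
  generalize q1 - q2 = d
  ring

theorem hasDerivAt_factorB_q (h4 : q1 + q2 ≠ 0) :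
    HasDerivAt (fun x => factorB a b x q2 p1 p2) (dqFactorB a b q1 q2 p1 p2) q1 := by
  have X := hasDerivAt_id q1
  have hd := (X.sub_const q2).pow 2
  have hK := ((X.pow 2).mul_const (q2^2)).mul ((((X.pow 2).mul_const p1).sub_const (q2^2*p2)).pow 2)
  have ha := (((X.const_mul (-4*a)).mul_const q2).mul hd).div (X.add_const q2) h4
  have hb := (((X.pow 2).const_mul (2*b)).mul_const (q2^2)).mul hd
  refine (hK.add (ha.add hb)).congr_deriv ?_
  simp only [dqFactorB, id, Pi.pow_apply, Pi.mul_apply]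
  field_simp
  ring

theorem hasDerivAt_factorB_p :
    HasDerivAt (fun x => factorB a b q1 q2 x p2)
      (2*q1^4*q2^2*(q1^2*p1 - q2^2*p2)) p1 := by
  have h := (((((hasDerivAt_id p1).const_mul (q1^2)).sub_const (q2^2*p2)).pow 2).const_mul
    (q1^2*q2^2)).add_const
    (-4*a*q1*q2*(q1 - q2)^2/(q1 + q2) + 2*b*q1^2*q2^2*(q1 - q2)^2)
  refine h.congr_deriv ?_
  simp only [id]
  ring

end Derivatives

/-- Both factors of `H2` are Darboux functions of the flow of `H1`; this is the cofactor of the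
squared one, up to sign. -/
noncomputable def cofactor (q1 q2 p1 p2 : ℝ) : ℝ :=
  3*((q1^4 + 2*q1^3*q2 - q1^2*q2^2)*p1 + (q2^4 + 2*q1*q2^3 - q1^2*q2^2)*p2)/(q1 - q2)^2

theorem bracket_factorA (a b c : ℝ) {q1 q2 : ℝ} (p1 p2 : ℝ) (h1 : q1 ≠ 0) (h2 : q2 ≠ 0)
    (h3 : q1 - q2 ≠ 0) (h4 : q1 + q2 ≠ 0) :
    dqH1 a b c q1 q2 p1 p2 * (2*(p1 - p2)/(q1 - q2)^6)
      - dpH1 q1 q2 p1 * dqFactorA a c q1 q2 p1 p2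
      + dqH1 a b c q2 q1 p2 p1 * (2*(p2 - p1)/(q2 - q1)^6)
      - dpH1 q2 q1 p2 * dqFactorA a c q2 q1 p2 p1
      = 2 * cofactor q1 q2 p1 p2 * factorA a c q1 q2 p1 p2 := by
  have h3s : q2 - q1 = -(q1 - q2) := by ring
  have h4s : q2 + q1 = q1 + q2 := by ring
  simp only [dqH1, dpH1, dqFactorA, cofactor, factorA, h3s, h4s]
  field_simp
  ring

theorem bracket_factorB (a b c : ℝ) {q1 q2 : ℝ} (p1 p2 : ℝ) (h1 : q1 ≠ 0) (h2 : q2 ≠ 0)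
    (h3 : q1 - q2 ≠ 0) (h4 : q1 + q2 ≠ 0) :
    dqH1 a b c q1 q2 p1 p2 * (2*q1^4*q2^2*(q1^2*p1 - q2^2*p2))
      - dpH1 q1 q2 p1 * dqFactorB a b q1 q2 p1 p2
      + dqH1 a b c q2 q1 p2 p1 * (2*q2^4*q1^2*(q2^2*p2 - q1^2*p1))
      - dpH1 q2 q1 p2 * dqFactorB a b q2 q1 p2 p1
      = -cofactor q1 q2 p1 p2 * factorB a b q1 q2 p1 p2 := by
  have h3s : q2 - q1 = -(q1 - q2) := by ring
  have h4s : q2 + q1 = q1 + q2 := by ring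
  simp only [dqH1, dpH1, dqFactorB, cofactor, factorB, h3s, h4s]
  field_simp
  ring

theorem stmt7 (a b c q1 q2 p1 p2 : ℝ) (h1 : q1 ≠ 0) (h2 : q2 ≠ 0)
    (h3 : q1 ≠ q2) (h4 : q1 + q2 ≠ 0) :
    pb (H1 a b c) (H2 a b c) q1 q2 p1 p2 = 0 := by
  have h3' : q1 - q2 ≠ 0 := sub_ne_zero.mpr h3
  have h3'' : q2 - q1 ≠ 0 := sub_ne_zero.mpr h3.symm
  have h4' : q2 + q1 ≠ 0 := by rwa [add_comm]
  have hH2 : ∀ x y u v, H2 a b c x y u v = factorA a c x y u v * factorB a b x y u v ^ 2 :=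
    fun _ _ _ _ => rfl
  have hH1q := (hasDerivAt_H1_q a b c p1 p2 h1 h2 h3' h4).deriv
  have hH1p := (hasDerivAt_H1_p a b c (q1 := q1) (q2 := q2) p1 p2).deriv
  have hH1q' := (hasDerivAt_H1_q a b c p2 p1 h2 h1 h3'' h4').deriv
  have hH1p' := (hasDerivAt_H1_p a b c (q1 := q2) (q2 := q1) p2 p1).deriv
  have hAq' := hasDerivAt_factorA_q a c p2 p1 h2 h1 h3''
  have hAp' := hasDerivAt_factorA_p a c (q1 := q2) (q2 := q1) p2 p1
  have hBq' := hasDerivAt_factorB_q a b p2 p1 h4'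
  have hBp' := hasDerivAt_factorB_p a b (q1 := q2) (q2 := q1) p2 p1
  simp only [← H1_swap a b c q1, ← factorA_swap a c q1, ← factorB_swap a b q1]
    at hH1q' hH1p' hAq' hAp' hBq' hBp'
  have hq := ((hasDerivAt_factorA_q a c p1 p2 h1 h2 h3').mul
    ((hasDerivAt_factorB_q a b p1 p2 h4).pow 2)).deriv
  have hp := ((hasDerivAt_factorA_p a c (q1 := q1) (q2 := q2) p1 p2).mul
    ((hasDerivAt_factorB_p a b (q1 := q1) (q2 := q2) p1 p2).pow 2)).deriv
  have hq' := (hAq'.mul (hBq'.pow 2)).deriv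
  have hp' := (hAp'.mul (hBp'.pow 2)).deriv
  simp only [Pi.mul_def, Pi.pow_def] at hq hp hq' hp'
  simp only [pb, hH2]
  rw [hH1q, hH1p, hH1q', hH1p', hq, hp, hq', hp']
  linear_combination
    factorB a b q1 q2 p1 p2 ^ 2 * bracket_factorA a b c p1 p2 h1 h2 h3' h4
      + 2 * factorA a c q1 q2 p1 p2 * factorB a b q1 q2 p1 p2
        * bracket_factorB a b c p1 p2 h1 h2 h3' h4
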